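/- Let F ⊆ [0,1] be a non-trivial self-similar set in ℝ whose defining IFS does not satisfy the weak separation property. Then there exists a ∈ F such that some closed interval of length 1 with endpoint a is a weak pseudo-tangent of F. -/

import Mathlib

open Set Metric Filter Function MeasureTheory

/-- The Assouad dimension of a subset of a metric space: the infimum of all `s ≥ 0`
for which there is a constant `K > 0` such that for all `0 < ρ < r ≤ 1`, every ball
of radius `r` centred in the set can be covered by at most `K (r/ρ)^s` open balls of
radius `ρ`. -/
noncomputable def assouadDim {X : Type*} [MetricSpace X] (A : Set X) : ℝ :=
  sInf {s : ℝ | 0 ≤ s ∧ ∃ K : ℝ, 0 < K ∧ ∀ r ρ : ℝ, 0 < ρ → ρ < r → r ≤ 1 →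
    ∀ x ∈ A, ∃ t : Finset X, (A ∩ Metric.ball x r ⊆ ⋃ y ∈ t, Metric.ball y ρ) ∧
      (t.card : ℝ) ≤ K * (r / ρ) ^ s}

/-- The composition `S_{i₁} ∘ ⋯ ∘ S_{i_k}` associated to a finite word. -/
def wordMap {ι X : Type*} (S : ι → X → X) : List ι → X → X
  | [] => id
  | i :: w => S i ∘ wordMap S w

/-- The weak separation property: the identity is not in the closure (for the topology of
pointwise convergence) of the set of maps `S_α⁻¹ ∘ S_β` for distinct nonempty words
`α ≠ β`, with the identity itself removed. -/
def SatisfiesWSP {ι X : Type*} [Nonempty X] [TopologicalSpace X] (S : ι → X → X) : Prop :=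
  id ∉ closure ({g : X → X | ∃ w₁ w₂ : List ι, w₁ ≠ [] ∧ w₂ ≠ [] ∧ w₁ ≠ w₂ ∧
      g = Function.invFun (wordMap S w₁) ∘ wordMap S w₂} \ {id})

/-- Some closed ball of positive radius `L` lies in the closed `η * L`-neighbourhood of `F`. -/
def HasDenseBall (F : Set ℝ) (η : ℝ) : Prop :=
  ∃ p L : ℝ, 0 < L ∧ ∀ x, |x - p| ≤ L → ∃ y ∈ F, |x - y| ≤ η * L

theorem exists_affine_of_dist_eq {f : ℝ → ℝ} {r : ℝ} (hr : 0 < r)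
    (hf : ∀ x y, dist (f x) (f y) = r * dist x y) :
    ∃ a b : ℝ, |a| = r ∧ ∀ x, f x = a * x + b := by
  have hsq : ∀ x y, (f x - f y) ^ 2 = r ^ 2 * (x - y) ^ 2 := fun x y => by
    have h := hf x y
    rw [Real.dist_eq, Real.dist_eq] at h
    rw [← sq_abs, h, mul_pow, sq_abs]
  have ha : |f 1 - f 0| = r := by
    have h := hf 1 0
    simpa [Real.dist_eq] using h
  refine ⟨f 1 - f 0, f 0, ha, fun x => ?_⟩
  have hne : f 1 - f 0 ≠ 0 := abs_pos.1 (ha ▸ hr)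
  have h : (f 1 - f 0) * (f x - ((f 1 - f 0) * x + f 0)) = 0 := by
    linear_combination (1 / 2) * hsq x 0 - (1 / 2) * hsq x 1 + (1 / 2 - x) * hsq 1 0
  linarith [(mul_eq_zero.1 h).resolve_left hne]

theorem exists_affine_wordMap {ι : Type*} {S : ι → ℝ → ℝ} {a b : ι → ℝ} {F : Set ℝ}
    (ha : ∀ i, a i ≠ 0) (hS : ∀ i x, S i x = a i * x + b i) (hF : ∀ i, MapsTo (S i) F F)
    (w : List ι) :
    MapsTo (wordMap S w) F F ∧ ∃ A B : ℝ, A ≠ 0 ∧ ∀ x, wordMap S w x = A * x + B := by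
  induction w with
  | nil => exact ⟨mapsTo_id F, 1, 0, one_ne_zero, fun x => by simp [wordMap]⟩
  | cons i w ih =>
    obtain ⟨hm, A, B, hA, hw⟩ := ih
    refine ⟨(hF i).comp hm, a i * A, a i * B + b i, mul_ne_zero (ha i) hA, fun x => ?_⟩
    simp only [wordMap, comp_apply, hw, hS]
    ring

/-- Every point of the attractor lies in a cylinder whose ratio is comparable to `ρ`. -/
theorem exists_cylinder {ι : Type*} {a b : ι → ℝ} {F : Set ℝ} {m M : ℝ}
    (hm : 0 < m) (hm1 : m ≤ 1) (hma : ∀ i, m ≤ |a i|) (haM : ∀ i, |a i| ≤ M)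
    (hF : F = ⋃ i, (fun x => a i * x + b i) '' F) (n : ℕ) :
    ∀ ρ : ℝ, M ^ n ≤ ρ → ρ ≤ 1 → ∀ x ∈ F, ∃ A B : ℝ, m * ρ ≤ |A| ∧ |A| ≤ ρ ∧
      MapsTo (fun x => A * x + B) F F ∧ ∃ y ∈ F, A * y + B = x := by
  induction n with
  | zero =>
    intro ρ h1 h2 x hx
    rw [pow_zero] at h1
    refine ⟨1, 0, ?_, by simpa using h1, fun z hz => by simpa using hz, x, hx, by simp⟩
    rw [abs_one]
    nlinarith
  | succ n ih =>
    intro ρ h1 h2 x hx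
    have hx' := hx
    rw [hF] at hx'
    obtain ⟨i, y, hy, hyx⟩ := mem_iUnion.1 hx'
    have hmaps : MapsTo (fun x => a i * x + b i) F F := fun z hz => by
      rw [hF]
      exact mem_iUnion.2 ⟨i, z, hz, rfl⟩
    have hai : 0 < |a i| := hm.trans_le (hma i)
    rcases le_or_gt |a i| ρ with h | h
    · refine ⟨a i, b i, ?_, h, hmaps, y, hy, hyx⟩
      nlinarith [hma i]
    · have hM : 0 ≤ M := hai.le.trans (haM i)
      obtain ⟨A, B, hA1, hA2, hAm, z, hz, hzy⟩ := ih (ρ / |a i|)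
        (by
          rw [le_div_iff₀ hai]
          refine le_trans ?_ h1
          rw [pow_succ]
          exact mul_le_mul_of_nonneg_left (haM i) (pow_nonneg hM n))
        ((div_le_one hai).2 h.le) y hy
      refine ⟨a i * A, a i * B + b i, ?_, ?_, fun t ht => ?_, z, hz, ?_⟩
      · rw [abs_mul]
        calc m * ρ = |a i| * (m * (ρ / |a i|)) := by field_simp
          _ ≤ _ := mul_le_mul_of_nonneg_left hA1 hai.le
      · rw [abs_mul]
        calc |a i| * |A| ≤ |a i| * (ρ / |a i|) := mul_le_mul_of_nonneg_left hA2 hai.le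
          _ = ρ := by field_simp
      · have h3 := hmaps (hAm ht)
        simp only at h3
        convert h3 using 1
        ring
      · simp only at hyx
        rw [← hyx, ← hzy]
        ring

/-- Two nearly equal, overlapping balls that are displaced by a definite proportion of their
radius contain a definitely larger ball in their union. -/
theorem mem_or_mem_of_displaced_balls {P Ψ R R' s κ x : ℝ} (hR : 0 < R)
    (hs : s ≤ 1 / 2) (hR' : (1 - s) * R ≤ R') (h1 : |Ψ| ≤ R) (h2 : κ * R ≤ |Ψ|)
    (hs0 : 0 ≤ s) (hx : |x - (P + Ψ / 2)| ≤ R * (1 + κ / 2 - s)) :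
    |x - P| ≤ R ∨ |x - (P + Ψ)| ≤ R' := by
  by_contra! h
  obtain ⟨h3, h4⟩ := h
  have h5 : 0 ≤ s * R := by positivity
  have h6 : s * R ≤ 1 / 2 * R := by gcongr
  rw [abs_le] at hx
  obtain ⟨hx1, hx2⟩ := hx
  rcases lt_abs.1 h3 with h3 | h3 <;> rcases lt_abs.1 h4 with h4 | h4 <;>
    rcases abs_cases Ψ with ⟨h7, h8⟩ | ⟨h7, h8⟩ <;> rw [h7] at h1 h2 <;> nlinarith

theorem exists_near_of_affine {F : Set ℝ} {p L ε A B A' B' : ℝ} (hA : A ≠ 0)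
    (hm : MapsTo (fun x => A * x + B) F F) (hA' : A' ≠ 0)
    (hm' : MapsTo (fun x => A' * x + B') F F)
    (h : ∀ x, |x - p| ≤ L → ∃ y ∈ F, |x - y| ≤ ε) {x : ℝ}
    (hx : |x - (A' * (A * p + B) + B')| ≤ |A'| * (|A| * L)) :
    ∃ y ∈ F, |x - y| ≤ |A'| * (|A| * ε) := by
  have key : ∀ y, x - (A' * (A * y + B) + B') = A' * (A * (((x - B') / A' - B) / A - y)) := by
    intro y
    field_simp
    ring
  rw [key, abs_mul, abs_mul] at hx
  have hA0 := abs_pos.2 hA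
  have hA0' := abs_pos.2 hA'
  obtain ⟨y, hy, hxy⟩ := h _ (le_of_mul_le_mul_left (le_of_mul_le_mul_left hx hA0') hA0)
  refine ⟨_, hm' (hm hy), ?_⟩
  simp only
  rw [key, abs_mul, abs_mul]
  gcongr

theorem HasDenseBall.improve {ι : Type*} {a b : ι → ℝ} {F : Set ℝ} {m M η : ℝ}
    (hm : 0 < m) (hm1 : m ≤ 1) (hM1 : M < 1)
    (hma : ∀ i, m ≤ |a i|) (haM : ∀ i, |a i| ≤ M)
    (hF : F = ⋃ i, (fun x => a i * x + b i) '' F) (hFsub : F ⊆ Icc 0 1)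
    (hnt : F.Nontrivial)
    (hclose : ∀ p ∈ F, ∀ q ∈ F, p ≠ q → ∀ δ > 0, ∃ A B s t : ℝ, A ≠ 0 ∧
      MapsTo (fun x => A * x + B) F F ∧
      MapsTo (fun x => A * ((1 + s) * x + t) + B) F F ∧
      |s * p + t| < δ ∧ |s * q + t| < δ ∧ (s ≠ 0 ∨ t ≠ 0))
    (hη : 0 ≤ η) (h : HasDenseBall F η) :
    HasDenseBall F (η * ((1 + m / 24) / (1 + m / 8))) := by
  obtain ⟨p, L, hL, hcov⟩ := h
  obtain ⟨p₀, hp₀, q₀, hq₀, hpq⟩ := hnt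
  set d := |p₀ - q₀| with hd
  have hdpos : 0 < d := abs_pos.2 (sub_ne_zero.2 hpq)
  obtain ⟨δ, hδ, hδ1, hδ2, hδ3⟩ : ∃ δ > 0, 3 * δ ≤ 2 * L * m ∧ 48 * δ ≤ m * d ∧
      3 * δ * (|p| + 1) * 4 ≤ d * (2 * L * m) := by
    refine ⟨min (2 * L * m / 3) (min (m * d / 48) (d * (2 * L * m) / (12 * (|p| + 1)))),
      by positivity, ?_, ?_, ?_⟩
    · have := min_le_left (2 * L * m / 3) (min (m * d / 48) (d * (2 * L * m) / (12 * (|p| + 1))))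
      linarith
    · have := (min_le_right (2 * L * m / 3) _).trans
        (min_le_left (m * d / 48) (d * (2 * L * m) / (12 * (|p| + 1))))
      linarith
    · have := (min_le_right (2 * L * m / 3) _).trans
        (min_le_right (m * d / 48) (d * (2 * L * m) / (12 * (|p| + 1))))
      rw [le_div_iff₀ (by positivity)] at this
      linarith
  obtain ⟨A, B, s, t, hA, hmA, hmB, hsp, hsq, hst⟩ := hclose p₀ hp₀ q₀ hq₀ hpq δ hδ
  -- the point of the pair displaced the most
  obtain ⟨x, hx, hxδ, hxpos, hsx⟩ : ∃ x ∈ F, |s * x + t| < δ ∧ 0 < |s * x + t| ∧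
      |s| * d ≤ 2 * |s * x + t| := by
    have hdiff : |s| * d ≤ |s * p₀ + t| + |s * q₀ + t| := by
      rw [hd, ← abs_mul, show s * (p₀ - q₀) = (s * p₀ + t) - (s * q₀ + t) by ring]
      exact abs_sub _ _
    have hne : ∀ z, |s| * d ≤ 2 * |s * z + t| → 0 < |s * z + t| := by
      intro z hz
      by_contra! hle
      have h0 : |s * z + t| = 0 := le_antisymm hle (abs_nonneg _)
      have hs0 : s = 0 := by
        by_contra hs
        have := mul_pos (abs_pos.2 hs) hdpos
        linarith
      have ht0 : t = 0 := by simpa [hs0] using h0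
      exact hst.elim (fun h => h hs0) (fun h => h ht0)
    rcases le_total |s * p₀ + t| |s * q₀ + t| with hle | hle
    · exact ⟨q₀, hq₀, hsq, hne _ (by linarith), by linarith⟩
    · exact ⟨p₀, hp₀, hsp, hne _ (by linarith), by linarith⟩
  set N := |s * x + t| with hN
  have hsm : |s| ≤ m / 24 := by
    refine le_of_mul_le_mul_right (hsx.trans ?_) hdpos
    linarith
  have hρ1 : 3 * N / (2 * L * m) ≤ 1 := by
    rw [div_le_one (by positivity)]
    linarith
  have hρ0 : 0 < 3 * N / (2 * L * m) := by positivity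
  obtain ⟨n, hn⟩ := exists_pow_lt_of_lt_one hρ0 hM1
  obtain ⟨A₁, B₁, hl, hu, hm₁, y, hy, hyx⟩ :=
    exists_cylinder hm hm1 hma haM hF n _ hn.le hρ1 x hx
  have hA₁ : 0 < |A₁| := lt_of_lt_of_le (by positivity) hl
  have hl' : 3 * N ≤ 2 * (|A₁| * L) := by
    have h1 : m * (3 * N / (2 * L * m)) = 3 * N / (2 * L) := by field_simp
    rw [h1, div_le_iff₀ (by positivity)] at hl
    linarith
  have hu' : |A₁| * (2 * L * m) ≤ 3 * N := (le_div_iff₀ (by positivity)).1 hu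
  set φ := s * (A₁ * p + B₁) + t with hφ
  have hvar : |φ - (s * x + t)| ≤ N / 2 := by
    have h1 : φ - (s * x + t) = s * (A₁ * (p - y)) := by
      rw [hφ, ← hyx]
      ring
    have h2 : |p - y| ≤ |p| + 1 := by
      refine (abs_sub p y).trans ?_
      have := hFsub hy
      rw [abs_of_nonneg this.1]
      linarith [this.2]
    have h3 : |A₁| * |p - y| ≤ d / 4 := by
      have h4 : |A₁| * |p - y| ≤ |A₁| * (|p| + 1) := by gcongr
      have h5 : |A₁| * (2 * L * m) * (|p| + 1) ≤ 3 * δ * (|p| + 1) := 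
        mul_le_mul_of_nonneg_right (hu'.trans (by linarith)) (by positivity)
      have h6 : |A₁| * (|p| + 1) ≤ d / 4 := by
        refine le_of_mul_le_mul_right ?_ (show 0 < 2 * L * m by positivity)
        linarith
      linarith
    rw [h1, abs_mul, abs_mul]
    have h7 : |s| * (|A₁| * |p - y|) ≤ |s| * (d / 4) := by gcongr
    linarith
  have hφu : |φ| ≤ |A₁| * L := by
    have := abs_sub_abs_le_abs_sub φ (s * x + t)
    linarith
  have hφl : m / 3 * (|A₁| * L) ≤ |φ| := by
    have := abs_sub_abs_le_abs_sub (s * x + t) φ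
    rw [abs_sub_comm] at this
    linarith
  have hs1 : 0 < 1 + s := by linarith [neg_abs_le s]
  have hA0 : 0 < |A| := abs_pos.2 hA
  have hR : 0 < |A| * (|A₁| * L) := by positivity
  have hsu : 1 + s ≤ 1 + m / 24 := by linarith [le_abs_self s]
  refine ⟨A * (A₁ * p + B₁) + B + A * φ / 2, |A| * (|A₁| * L) * (1 + m / 3 / 2 - |s|),
    mul_pos hR (by linarith), fun z hz => ?_⟩
  have hgoal : |A| * (|A₁| * (η * L)) * (1 + m / 24) ≤
      η * ((1 + m / 24) / (1 + m / 8)) * (|A| * (|A₁| * L) * (1 + m / 3 / 2 - |s|)) := by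
    have h1 : |A| * (|A₁| * (η * L)) * (1 + m / 24) =
        η * ((1 + m / 24) / (1 + m / 8)) * (|A| * (|A₁| * L) * (1 + m / 8)) := by
      field_simp
    rw [h1]
    gcongr
    linarith
  have hnn : 0 ≤ |A| * (|A₁| * (η * L)) := by positivity
  rcases mem_or_mem_of_displaced_balls (R' := |A| * (|A₁| * L) * (1 + s)) hR (by linarith)
      (by rw [mul_comm]; gcongr; linarith [neg_abs_le s])
      (by rw [abs_mul]; gcongr) (κ := m / 3)
      (by rw [abs_mul, mul_left_comm]; gcongr) (abs_nonneg s) hz with h | h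
  · obtain ⟨w, hw, hzw⟩ := exists_near_of_affine (abs_pos.1 hA₁) hm₁ hA hmA hcov h
    refine ⟨w, hw, hzw.trans (le_trans ?_ hgoal)⟩
    exact le_mul_of_one_le_right hnn (by linarith)
  · have hmB' : MapsTo (fun x => A * (1 + s) * x + (A * t + B)) F F := by
      intro x hx
      convert hmB hx using 1
      ring
    have habs : |A * (1 + s)| = |A| * (1 + s) := by rw [abs_mul, abs_of_pos hs1]
    obtain ⟨w, hw, hzw⟩ := exists_near_of_affine (x := z) (abs_pos.1 hA₁) hm₁
      (mul_ne_zero hA hs1.ne') hmB' hcov (by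
        have heq : A * (1 + s) * (A₁ * p + B₁) + (A * t + B) =
            A * (A₁ * p + B₁) + B + A * φ := by
          rw [hφ]
          ring
        rw [habs, heq, mul_right_comm]
        exact h)
    refine ⟨w, hw, hzw.trans (le_trans ?_ hgoal)⟩
    rw [habs]
    calc |A| * (1 + s) * (|A₁| * (η * L)) = |A| * (|A₁| * (η * L)) * (1 + s) := by ring
      _ ≤ _ := by gcongr

theorem HasDenseBall.mono {F : Set ℝ} {η η' : ℝ} (h : HasDenseBall F η) (hle : η ≤ η') :
    HasDenseBall F η' := by
  obtain ⟨p, L, hL, h⟩ := h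
  refine ⟨p, L, hL, fun x hx => ?_⟩
  obtain ⟨y, hy, hxy⟩ := h x hx
  exact ⟨y, hy, hxy.trans (by gcongr)⟩

/-- Failure of the weak separation property yields pairs of cylinder maps that are distinct but
arbitrarily close relative to their size. -/
theorem exists_close_maps_of_not_wsp {ι : Type*} {S : ι → ℝ → ℝ} {a b : ι → ℝ} {F : Set ℝ}
    (ha : ∀ i, a i ≠ 0) (hS : ∀ i x, S i x = a i * x + b i) (hF : ∀ i, MapsTo (S i) F F)
    (hWSP : ¬ SatisfiesWSP S) (p q : ℝ) {δ : ℝ} (hδ : 0 < δ) :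
    ∃ A B s t : ℝ, A ≠ 0 ∧ MapsTo (fun x => A * x + B) F F ∧
      MapsTo (fun x => A * ((1 + s) * x + t) + B) F F ∧
      |s * p + t| < δ ∧ |s * q + t| < δ ∧ (s ≠ 0 ∨ t ≠ 0) := by
  rw [SatisfiesWSP, not_not, _root_.mem_closure_iff] at hWSP
  obtain ⟨g, ⟨hgp, hgq⟩, ⟨w₁, w₂, -, -, -, hg⟩, hgid⟩ := hWSP
    ({g : ℝ → ℝ | |g p - p| < δ} ∩ {g : ℝ → ℝ | |g q - q| < δ})
    ((isOpen_lt (by fun_prop) continuous_const).inter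
      (isOpen_lt (by fun_prop) continuous_const)) (by simpa using hδ)
  obtain ⟨hm₁, A₁, B₁, hA₁, h₁⟩ := exists_affine_wordMap ha hS hF w₁
  obtain ⟨hm₂, A₂, B₂, hA₂, h₂⟩ := exists_affine_wordMap ha hS hF w₂
  have hgx : ∀ x, g x = (A₂ * x + B₂ - B₁) / A₁ := by
    intro x
    have hex : ∃ y, wordMap S w₁ y = wordMap S w₂ x :=
      ⟨(A₂ * x + B₂ - B₁) / A₁, by rw [h₁, h₂]; field_simp; ring⟩
    have := Function.invFun_eq hex
    rw [hg, comp_apply, eq_div_iff hA₁]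
    rw [h₁, h₂] at this
    rw [h₂]
    linarith
  have hsub : ∀ x, g x - x = (A₂ / A₁ - 1) * x + (B₂ - B₁) / A₁ := by
    intro x
    rw [hgx]
    field_simp
    ring
  refine ⟨A₁, B₁, A₂ / A₁ - 1, (B₂ - B₁) / A₁, hA₁, ?_, ?_, ?_, ?_, ?_⟩
  · exact fun x hx => by simpa only [h₁] using hm₁ hx
  · intro x hx
    have := hm₂ hx
    rw [h₂] at this
    convert this using 1
    field_simp
    ring
  · rw [← hsub]; exact hgp
  · rw [← hsub]; exact hgq
  · by_contra! hst
    refine hgid (funext fun x => ?_)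
    have := hsub x
    rw [hst.1, hst.2] at this
    simp only [id]
    linarith

theorem hasDenseBall_of_not_wsp {ι : Type*} [Fintype ι] [Nonempty ι]
    {S : ι → ℝ → ℝ} {c : ι → ℝ} (hc : ∀ i, c i ∈ Ioo (0 : ℝ) 1)
    (hsim : ∀ i x y, dist (S i x) (S i y) = c i * dist x y) {F : Set ℝ}
    (hFattr : F = ⋃ i, S i '' F) (hFsub : F ⊆ Icc (0 : ℝ) 1) (hFnt : F.Nontrivial)
    (hWSP : ¬ SatisfiesWSP S) {η : ℝ} (hη : 0 < η) : HasDenseBall F η := by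
  choose a b hac hS using fun i => exists_affine_of_dist_eq (hc i).1 (hsim i)
  have ha : ∀ i, a i ≠ 0 := fun i => abs_pos.1 (hac i ▸ (hc i).1)
  have hmaps : ∀ i, MapsTo (S i) F F := fun i x hx => by
    rw [hFattr]
    exact mem_iUnion.2 ⟨i, x, hx, rfl⟩
  have hF : F = ⋃ i, (fun x => a i * x + b i) '' F := by
    simpa only [← hS] using hFattr
  obtain ⟨i₀, hi₀⟩ := Finite.exists_min c
  obtain ⟨i₁, hi₁⟩ := Finite.exists_max c
  have hm := (hc i₀).1
  set θ := (1 + c i₀ / 24) / (1 + c i₀ / 8) with hθ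
  have hθ0 : 0 ≤ θ := by positivity
  have hθ1 : θ < 1 := by
    rw [hθ, div_lt_one (by positivity)]
    linarith
  have hpow : ∀ n : ℕ, HasDenseBall F (2 * θ ^ n) := by
    intro n
    induction n with
    | zero =>
      obtain ⟨p, hp⟩ := hFnt.nonempty
      exact ⟨p, 1, one_pos, fun x hx => ⟨p, hp, by simpa using hx.trans one_le_two⟩⟩
    | succ n ih =>
      rw [pow_succ, ← mul_assoc]
      refine HasDenseBall.improve hm (hc i₀).2.le (hc i₁).2
        (fun i => (hi₀ i).trans_eq (hac i).symm) (fun i => (hac i).trans_le (hi₁ i)) hF hFsub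
        hFnt ?_ (by positivity) ih
      exact fun p _ q _ _ δ hδ => exists_close_maps_of_not_wsp ha hS hmaps hWSP p q hδ
  obtain ⟨n, hn⟩ := exists_pow_lt_of_lt_one (half_pos hη) hθ1
  exact (hpow n).mono (by linarith)

/-- **An interval is a weak pseudo-tangent when the WSP fails on the line.**
Let `F ⊆ [0,1]` be a non-trivial self-similar set in `ℝ` whose defining IFS of
contracting similarities does not satisfy the weak separation property.  Then there is
a point `a ∈ F` and a closed interval of length `1` with endpoint `a` which is a weak
pseudo-tangent of `F`: there are similarity maps `T k : ℝ → ℝ` with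
`sup_{x ∈ [a,b]} inf_{y ∈ T k '' F} |x - y| → 0`. -/
theorem interval_weak_pseudo_tangent_of_not_wsp {ι : Type} [Fintype ι] [Nonempty ι]
    (S : ι → ℝ → ℝ) (c : ι → ℝ)
    (hc : ∀ i, c i ∈ Set.Ioo (0 : ℝ) 1)
    (hsim : ∀ i x y, dist (S i x) (S i y) = c i * dist x y)
    (F : Set ℝ) (hFcomp : IsCompact F) (hFne : F.Nonempty)
    (hFattr : F = ⋃ i, S i '' F) (hFsub : F ⊆ Set.Icc (0 : ℝ) 1)
    (hFnt : F.Nontrivial)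
    (hWSP : ¬ SatisfiesWSP S) :
    ∃ a ∈ F, ∃ b : ℝ, |b - a| = 1 ∧
      ∃ (T : ℕ → ℝ → ℝ) (u : ℕ → ℝ), (∀ k, 0 < u k) ∧
        (∀ k x y, dist (T k x) (T k y) = u k * dist x y) ∧
        Tendsto (fun k => ⨆ x : Set.uIcc a b, Metric.infDist (x : ℝ) (T k '' F))
          atTop (nhds 0) := by
  obtain ⟨a, ha⟩ := hFne
  refine ⟨a, ha, a + 1, by simp, ?_⟩
  have hdense : ∀ k : ℕ, HasDenseBall F (1 / ((k : ℝ) + 1)) := fun k =>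
    hasDenseBall_of_not_wsp hc hsim hFattr hFsub hFnt hWSP (by positivity)
  choose p L hL hcov using hdense
  refine ⟨fun k x => a + 1 / 2 + (x - p k) / (2 * L k), fun k => 1 / (2 * L k),
    fun k => by have := hL k; positivity, fun k x y => ?_, ?_⟩
  · have := hL k
    have heq : a + 1 / 2 + (x - p k) / (2 * L k) - (a + 1 / 2 + (y - p k) / (2 * L k)) =
        1 / (2 * L k) * (x - y) := by ring
    rw [Real.dist_eq, Real.dist_eq, heq, abs_mul,
      abs_of_pos (show 0 < 1 / (2 * L k) by positivity)]
  · refine squeeze_zero (fun k => Real.iSup_nonneg fun x => infDist_nonneg) (fun k => ?_)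
      (tendsto_one_div_add_atTop_nhds_zero_nat (𝕜 := ℝ))
    have : Nonempty (Set.uIcc a (a + 1)) := ⟨⟨a, left_mem_uIcc⟩⟩
    refine ciSup_le fun ⟨x, hx⟩ => ?_
    rw [uIcc_of_le (by linarith)] at hx
    have hLk := hL k
    obtain ⟨y, hy, hxy⟩ := hcov k (p k + 2 * L k * (x - a - 1 / 2)) (by
      rw [add_sub_cancel_left, abs_mul, abs_of_pos (show 0 < 2 * L k by positivity)]
      have : |x - a - 1 / 2| ≤ 1 / 2 := abs_le.2 ⟨by linarith [hx.1], by linarith [hx.2]⟩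
      nlinarith)
    refine (infDist_le_dist_of_mem (mem_image_of_mem _ hy)).trans ?_
    have heq : x - (a + 1 / 2 + (y - p k) / (2 * L k)) =
        (p k + 2 * L k * (x - a - 1 / 2) - y) / (2 * L k) := by
      field_simp
      ring
    rw [Real.dist_eq, heq, abs_div, abs_of_pos (show 0 < 2 * L k by positivity),
      div_le_iff₀ (by positivity)]
    refine hxy.trans ?_
    gcongr
    linarith
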